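/- Let G be a group and Γ a graph. If the Binary Cycle Test is valid for every gain graph (Γ, g, G) with gain group G, then for every edge set S ⊆ E(Γ) the Binary Cycle Test is valid for every gain graph (Γ/S, g, G), where Γ/S denotes Γ with the edges of S contracted (vertices in the same connected component of (V, S) are identified and the edges of S are deleted). -/

import Mathlib

set_option maxHeartbeats 1000000
set_option synthInstance.maxHeartbeats 400000

attribute [local instance] Classical.propDecidable

noncomputable section

/-- A multigraph: loops and multiple edges are allowed.  Each edge `e` has a
reference orientation, from `src e` to `tgt e`. -/
structure MGraph : Type 1 where
  V : Type
  E : Type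
  src : E → V
  tgt : E → V

/-- A class of groups (a property of groups). -/
abbrev GroupClass : Type 1 := (G : Type) → Group G → Prop

/-- A subgroup-closed class of groups. -/
def SubgroupClosed (𝒢 : GroupClass) : Prop :=
  ∀ (G : Type) [instG : Group G], 𝒢 G instG → ∀ H : Subgroup G, 𝒢 H inferInstance

/-- The number of occurrences of `a` in the list `l`. -/
def countIn {α : Type} (l : List α) (a : α) : ℕ :=
  (l.map fun x => if x = a then 1 else 0).sum

namespace MGraph

/-- A step of a walk: an edge together with a direction of traversal
(`true` = from `src` to `tgt`). -/
abbrev Step (Γ : MGraph) : Type := Γ.E × Bool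

def stepStart (Γ : MGraph) (s : Γ.Step) : Γ.V := if s.2 then Γ.src s.1 else Γ.tgt s.1

def stepEnd (Γ : MGraph) (s : Γ.Step) : Γ.V := if s.2 then Γ.tgt s.1 else Γ.src s.1

/-- `IsWalkFrom Γ a b l`: the list of steps `l` is a walk from `a` to `b`. -/
inductive IsWalkFrom (Γ : MGraph) : Γ.V → Γ.V → List Γ.Step → Prop
  | nil (v : Γ.V) : IsWalkFrom Γ v v []
  | cons {a b : Γ.V} {s : Γ.Step} {l : List Γ.Step} :
      Γ.stepStart s = a → IsWalkFrom Γ (Γ.stepEnd s) b l → IsWalkFrom Γ a b (s :: l)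

section Walks

variable (Γ : MGraph)

/-- The list of edges underlying a walk. -/
def walkEdges (l : List Γ.Step) : List Γ.E := l.map Prod.fst

/-- The list of vertices visited by a walk starting at `a`. -/
def walkVerts (a : Γ.V) (l : List Γ.Step) : List Γ.V := a :: l.map Γ.stepEnd

/-- A closed walk (given as its list of steps) is simple if it is nontrivial and
repeats no edge and no vertex (except that initial vertex = final vertex). -/
def IsSimpleClosed (l : List Γ.Step) : Prop :=
  l ≠ [] ∧ (Γ.walkEdges l).Nodup ∧ (l.map Γ.stepStart).Nodup

section Gain

variable {G : Type} [Group G]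

/-- The gain of a single step, for a gain function `g`. -/
def stepGain (g : Γ.E → G) (s : Γ.Step) : G := if s.2 then g s.1 else (g s.1)⁻¹

/-- The gain of a walk: the product of the gains of its steps, in order. -/
def walkGain (g : Γ.E → G) (l : List Γ.Step) : G := (l.map (Γ.stepGain g)).prod

/-- A gain graph is balanced if every simple closed walk has gain `1`. -/
def IsBalanced (g : Γ.E → G) : Prop :=
  ∀ (v : Γ.V) (l : List Γ.Step),
    Γ.IsWalkFrom v v l → Γ.IsSimpleClosed l → Γ.walkGain g l = 1

end Gain

/-- The mod-2 boundary map from edge chains to vertex chains. -/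
def boundary : (Γ.E →₀ ZMod 2) →ₗ[ZMod 2] (Γ.V →₀ ZMod 2) :=
  Finsupp.lsum (ZMod 2) fun e => Finsupp.lsingle (Γ.src e) + Finsupp.lsingle (Γ.tgt e)

/-- The binary cycle space `Z₁(Γ; ℤ₂)`: mod-2 edge chains with even degree at
every vertex. -/
def cycleSpace : Submodule (ZMod 2) (Γ.E →₀ ZMod 2) := LinearMap.ker Γ.boundary

/-- `B` is a basis of the binary cycle space of `Γ`. -/
def IsCycleBasis (B : Set (Γ.E →₀ ZMod 2)) : Prop :=
  (∀ c ∈ B, c ∈ Γ.cycleSpace) ∧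
  LinearIndependent (ZMod 2) (fun c : B => c.1) ∧
  ∀ c ∈ Γ.cycleSpace, c ∈ Submodule.span (ZMod 2) B

/-- The closed walk `l` is a cyclic orientation of the binary cycle `c`:
it is closed and its edge multiplicities reduced mod 2 give `c`. -/
def IsCyclicOrientation (c : Γ.E →₀ ZMod 2) (l : List Γ.Step) : Prop :=
  (∃ v, Γ.IsWalkFrom v v l) ∧ ∀ e : Γ.E, c e = (countIn (Γ.walkEdges l) e : ZMod 2)

/-- The binary cycle `c` is a circle: it is the (indicator of the) edge set of a
simple closed walk. -/
def IsCircleCycle (c : Γ.E →₀ ZMod 2) : Prop :=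
  ∃ l, Γ.IsSimpleClosed l ∧ Γ.IsCyclicOrientation c l

section Tests

variable {G : Type} [Group G]

/-- `B` passes the Binary Cycle Test: it has a cyclic orientation all of whose
closed walks have gain `1`. -/
def PassesBCT (g : Γ.E → G) (B : Set (Γ.E →₀ ZMod 2)) : Prop :=
  ∀ c ∈ B, ∃ l, Γ.IsCyclicOrientation c l ∧ Γ.walkGain g l = 1

/-- The Binary Cycle Test is valid for the gain graph `(Γ, g, G)`. -/
def BCTValid (g : Γ.E → G) : Prop :=
  (∃ B, Γ.IsCycleBasis B ∧ Γ.PassesBCT g B) → Γ.IsBalanced g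

/-- `c` is a circle whose natural traversal as a simple closed walk has gain 1. -/
def IsBalancedCircleCycle (g : Γ.E → G) (c : Γ.E →₀ ZMod 2) : Prop :=
  ∃ l, Γ.IsSimpleClosed l ∧ Γ.IsCyclicOrientation c l ∧ Γ.walkGain g l = 1

/-- The Circle Test is valid for the gain graph `(Γ, g, G)`: if some basis of the
binary cycle space consists of balanced circles, then the gain graph is balanced. -/
def CircleTestValid (g : Γ.E → G) : Prop :=
  (∃ B, Γ.IsCycleBasis B ∧ ∀ c ∈ B, Γ.IsBalancedCircleCycle g c) → Γ.IsBalanced g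

end Tests

/-- The Binary Cycle Test is valid for `Γ` with respect to the class `𝒢`. -/
def BCTValidFor (𝒢 : GroupClass) : Prop :=
  ∀ (G : Type) [instG : Group G], 𝒢 G instG → ∀ g : Γ.E → G, Γ.BCTValid g

/-- The Circle Test is valid for `Γ` with respect to the class `𝒢`
(`Γ` is a "good" graph for `𝒢`). -/
def CircleTestValidFor (𝒢 : GroupClass) : Prop :=
  ∀ (G : Type) [instG : Group G], 𝒢 G instG → ∀ g : Γ.E → G, Γ.CircleTestValid g

/-- Deletion of a set of edges. -/
def deleteEdges (S : Set Γ.E) : MGraph where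
  V := Γ.V
  E := {e : Γ.E // e ∉ S}
  src e := Γ.src e.1
  tgt e := Γ.tgt e.1

/-- The relation identifying the two endpoints of each edge of `S`. -/
def contractRel (S : Set Γ.E) : Γ.V → Γ.V → Prop :=
  fun x y => ∃ e ∈ S, Γ.src e = x ∧ Γ.tgt e = y

/-- Contraction `Γ/S`: vertices in the same component of `(V, S)` are identified
and the edges of `S` are deleted. -/
def contract (S : Set Γ.E) : MGraph where
  V := Quot (Γ.contractRel S)
  E := {e : Γ.E // e ∉ S}
  src e := Quot.mk _ (Γ.src e.1)
  tgt e := Quot.mk _ (Γ.tgt e.1)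

/-- The subgraph with vertex set `U` and edge set the edges of `T` having both
endpoints in `U`. -/
def subgraph (U : Set Γ.V) (T : Set Γ.E) : MGraph where
  V := U
  E := {e : Γ.E // e ∈ T ∧ Γ.src e ∈ U ∧ Γ.tgt e ∈ U}
  src e := ⟨Γ.src e.1, e.2.2.1⟩
  tgt e := ⟨Γ.tgt e.1, e.2.2.2⟩

/-- The set of vertices incident with an edge of `D`. -/
def edgeVerts (D : Set Γ.E) : Set Γ.V := {x | ∃ e ∈ D, Γ.src e = x ∨ Γ.tgt e = x}

/-- The subgraph spanned by an edge set `D`. -/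
def edgeSubgraph (D : Set Γ.E) : MGraph := Γ.subgraph (Γ.edgeVerts D) D

/-- Adjacency of vertices. -/
def Adj (x y : Γ.V) : Prop :=
  ∃ e : Γ.E, (Γ.src e = x ∧ Γ.tgt e = y) ∨ (Γ.src e = y ∧ Γ.tgt e = x)

/-- A graph with no loops. -/
def Loopless : Prop := ∀ e : Γ.E, Γ.src e ≠ Γ.tgt e

/-- A finite graph. -/
def IsFiniteGraph : Prop := Finite Γ.V ∧ Finite Γ.E

/-- A graph is inseparable if any two distinct edges lie in a common circle. -/
def Inseparable : Prop :=
  ∀ e f : Γ.E, e ≠ f →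
    ∃ (v : Γ.V) (l : List Γ.Step), Γ.IsWalkFrom v v l ∧ Γ.IsSimpleClosed l ∧
      e ∈ Γ.walkEdges l ∧ f ∈ Γ.walkEdges l

/-- `D` is (the edge set of) a block of `Γ`: a maximal inseparable subgraph. -/
def IsBlock (D : Set Γ.E) : Prop :=
  (Γ.edgeSubgraph D).Inseparable ∧
  ∀ D', D ⊆ D' → (Γ.edgeSubgraph D').Inseparable → D' = D

/-- The edge set `D` is a circle of `Γ`. -/
def IsCircleSet (D : Set Γ.E) : Prop :=
  ∃ (v : Γ.V) (l : List Γ.Step), Γ.IsWalkFrom v v l ∧ Γ.IsSimpleClosed l ∧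
    D = {e | e ∈ Γ.walkEdges l}

/-- The edge set `D` is a balanced circle for the gain function `g`. -/
def IsBalancedCircleSet {G : Type} [Group G] (g : Γ.E → G) (D : Set Γ.E) : Prop :=
  Γ.IsCircleSet D ∧
  ∀ (v : Γ.V) (l : List Γ.Step), Γ.IsWalkFrom v v l → Γ.IsSimpleClosed l →
    D = {e | e ∈ Γ.walkEdges l} → Γ.walkGain g l = 1

end Walks

/-- An isomorphism of multigraphs (preserving endpoints as unordered pairs). -/
structure Iso (Γ Δ : MGraph) where
  vEquiv : Γ.V ≃ Δ.V
  eEquiv : Γ.E ≃ Δ.E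
  ends_eq : ∀ e : Γ.E,
    s(Δ.src (eEquiv e), Δ.tgt (eEquiv e)) = s(vEquiv (Γ.src e), vEquiv (Γ.tgt e))

/-- `Δ` is a minor of `Γ`: `Δ` is isomorphic to a subgraph of a contraction of `Γ`. -/
def IsMinor (Δ Γ : MGraph) : Prop :=
  ∃ (S : Set Γ.E) (U : Set (Γ.contract S).V) (T : Set (Γ.contract S).E),
    Nonempty (Iso Δ ((Γ.contract S).subgraph U T))

/-- Subdivision of the edge `e₀` into a path of length two. -/
def subdivide (Γ : MGraph) (e₀ : Γ.E) : MGraph where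
  V := Γ.V ⊕ Unit
  E := Γ.E ⊕ Unit
  src := fun e => match e with
    | .inl e => Sum.inl (Γ.src e)
    | .inr _ => Sum.inr ()
  tgt := fun e => match e with
    | .inl e => if e = e₀ then Sum.inr () else Sum.inl (Γ.tgt e)
    | .inr _ => Sum.inl (Γ.tgt e₀)

/-- One subdivision step (up to isomorphism). -/
def SubdivisionStep (A B : MGraph) : Prop :=
  Nonempty (Iso B A) ∨ ∃ e₀ : A.E, Nonempty (Iso B (A.subdivide e₀))

/-- `Δ` is (isomorphic to) a graph obtained from `Γ₀` by subdividing edges. -/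
def IsSubdivisionOf (Δ Γ₀ : MGraph) : Prop :=
  ∃ Δ', Relation.ReflTransGen SubdivisionStep Γ₀ Δ' ∧ Nonempty (Iso Δ Δ')

/-- Two graphs are homeomorphic if both are obtained by subdividing edges of a
common graph. -/
def Homeomorphic (Γ₁ Γ₂ : MGraph) : Prop :=
  ∃ Γ₀, IsSubdivisionOf Γ₁ Γ₀ ∧ IsSubdivisionOf Γ₂ Γ₀

section Ops

variable (Γ : MGraph)

/-- Interchange `u` and `v`. -/
def twistVert (u v x : Γ.V) : Γ.V := if x = u then v else if x = v then u else x

/-- The result of twisting the edge set `A` across `{u, v}`: every endpoint of an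
edge of `A` at `u` is reconnected to `v` and vice versa. -/
def twist (u v : Γ.V) (A : Set Γ.E) : MGraph where
  V := Γ.V
  E := Γ.E
  src e := if e ∈ A then Γ.twistVert u v (Γ.src e) else Γ.src e
  tgt e := if e ∈ A then Γ.twistVert u v (Γ.tgt e) else Γ.tgt e

/-- `x` and `y` are joined by a walk all of whose vertices avoid `u` and `v`. -/
def AvoidConn (u v x y : Γ.V) : Prop :=
  ∃ l, Γ.IsWalkFrom x y l ∧ ∀ z ∈ Γ.walkVerts x l, z ≠ u ∧ z ≠ v

/-- `P` is the vertex set of a union of some, but not all, of the components of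
`Γ ∖ {u, v}` (the data of a Whitney twist across the 2-separation `{u,v}`). -/
def IsWhitneyTwistData (u v : Γ.V) (P : Set Γ.V) : Prop :=
  (∀ x ∈ P, x ≠ u ∧ x ≠ v) ∧
  (∀ x ∈ P, ∀ y, Γ.AvoidConn u v x y → y ∈ P) ∧
  P.Nonempty ∧ (∃ y : Γ.V, y ∉ P ∧ y ≠ u ∧ y ≠ v)

/-- `(v, w, F)` is valid data for extruding the vertex `v`: `w` is a neighbor of
`v` and `F` is a nonempty set of edges joining `v` and `w`. -/
def IsExtrusionData (v w : Γ.V) (F : Set Γ.E) : Prop :=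
  v ≠ w ∧ F.Nonempty ∧
  ∀ e ∈ F, (Γ.src e = v ∧ Γ.tgt e = w) ∨ (Γ.src e = w ∧ Γ.tgt e = v)

/-- Extrusion of a new vertex `v′` from `v`: the edges of `F` are reattached to
join `v′` to `w`, and a new edge joins `v` to `v′`. -/
def extrude (v w : Γ.V) (F : Set Γ.E) : MGraph where
  V := Γ.V ⊕ Unit
  E := Γ.E ⊕ Unit
  src := fun e => match e with
    | .inl e => if e ∈ F ∧ Γ.src e = v then Sum.inr () else Sum.inl (Γ.src e)
    | .inr _ => Sum.inl v
  tgt := fun e => match e with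
    | .inl e => if e ∈ F ∧ Γ.tgt e = v then Sum.inr () else Sum.inl (Γ.tgt e)
    | .inr _ => Sum.inr ()

end Ops

/-- `Δ` is obtained from `Γ` by extruding a vertex (up to isomorphism). -/
def IsExtrusionOf (Δ Γ : MGraph) : Prop :=
  ∃ (v w : Γ.V) (F : Set Γ.E),
    Γ.IsExtrusionData v w F ∧ Nonempty (Iso Δ (Γ.extrude v w F))

/-- `Γ` is extrusion-irreducible: it is not obtainable by extrusion from a
smaller graph. -/
def ExtrusionIrreducible (Γ : MGraph) : Prop := ¬ ∃ Δ : MGraph, IsExtrusionOf Γ Δ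

/-- `Δ` is obtained from `Γ₀` by a (possibly empty) sequence of extrusions,
up to isomorphism. -/
def ObtainedByExtrusions (Δ Γ₀ : MGraph) : Prop :=
  ∃ Δ', Relation.ReflTransGen (fun A B => IsExtrusionOf B A) Γ₀ Δ' ∧ Nonempty (Iso Δ Δ')

section Bridges

variable (Γ : MGraph)

/-- The walk `l` is internally disjoint from `{u, v}`. -/
def IntDisjWalk (u v : Γ.V) (l : List Γ.Step) : Prop :=
  ∀ z ∈ (l.map Γ.stepEnd).dropLast, z ≠ u ∧ z ≠ v

/-- Two edges lie in a common walk internally disjoint from `{u, v}`. -/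
def InBridgeRel (u v : Γ.V) (e f : Γ.E) : Prop :=
  ∃ (a b : Γ.V) (l : List Γ.Step), Γ.IsWalkFrom a b l ∧ Γ.IntDisjWalk u v l ∧
    e ∈ Γ.walkEdges l ∧ f ∈ Γ.walkEdges l

/-- `D` is (the edge set of) a bridge of `{u, v}`: a maximal set of edges any two
of which lie in a common walk internally disjoint from `{u, v}`. -/
def IsBridge (u v : Γ.V) (D : Set Γ.E) : Prop :=
  D.Nonempty ∧ (∀ e ∈ D, ∀ f ∈ D, Γ.InBridgeRel u v e f) ∧
  ∀ D', D ⊆ D' → (∀ e ∈ D', ∀ f ∈ D', Γ.InBridgeRel u v e f) → D' = D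

/-- The set `A` of vertices is connected using only edges of `D`, within `A`. -/
def SetConnWith (D : Set Γ.E) (A : Set Γ.V) : Prop :=
  ∀ x ∈ A, ∀ y ∈ A, ∃ l, Γ.IsWalkFrom x y l ∧ (∀ s ∈ l, s.1 ∈ D) ∧
    ∀ z ∈ Γ.walkVerts x l, z ∈ A

/-- The subgraph with edge set `D` has `2P_{2uv}` (a four-circle with `u`, `v` as
opposite vertices) as a minor rooted at `u` and `v`, expressed by branch sets. -/
def HasRooted2P2Minor (u v : Γ.V) (D : Set Γ.E) : Prop :=
  ∃ β : Fin 4 → Set Γ.V,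
    (∀ i j, i ≠ j → Disjoint (β i) (β j)) ∧
    (∀ i, (β i).Nonempty ∧ Γ.SetConnWith D (β i)) ∧
    u ∈ β 0 ∧ v ∈ β 2 ∧
    ∀ i : Fin 4, ∃ e ∈ D,
      (Γ.src e ∈ β i ∧ Γ.tgt e ∈ β (i + 1)) ∨ (Γ.src e ∈ β (i + 1) ∧ Γ.tgt e ∈ β i)

/-- Removing the vertex `w` disconnects the subgraph with edge set `D`. -/
def SeparatesBridge (D : Set Γ.E) (w : Γ.V) : Prop :=
  ∃ x ∈ Γ.edgeVerts D, ∃ y ∈ Γ.edgeVerts D, x ≠ w ∧ y ≠ w ∧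
    ¬ ∃ l, Γ.IsWalkFrom x y l ∧ (∀ s ∈ l, s.1 ∈ D) ∧ ∀ z ∈ Γ.walkVerts x l, z ≠ w

end Bridges

/-! ### Particular graphs -/

/-- `K₁°`: one vertex with one loop. -/
@[reducible] def loopGraph : MGraph where
  V := Unit
  E := Unit
  src _ := ()
  tgt _ := ()

/-- `mK₂`: two vertices joined by `m` parallel edges. -/
@[reducible] def banana (m : ℕ) : MGraph where
  V := Bool
  E := Fin m
  src _ := false
  tgt _ := true

/-- `C_l(m₁, …, m_l)`: a circle of length `l` whose `i`-th edge is replaced by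
`m i` parallel copies. -/
@[reducible] def multiCircle (l : ℕ) (m : Fin l → ℕ) : MGraph where
  V := Fin l
  E := Σ i : Fin l, Fin (m i)
  src e := e.1
  tgt e := ⟨(e.1.1 + 1) % l, Nat.mod_lt _ e.1.pos⟩

/-- `2C_n`: the circle of length `n` with every edge doubled. -/
@[reducible] def twoCircle (n : ℕ) : MGraph := multiCircle n fun _ => 2

/-- `K₄(m, m′)`: `K₄` with two opposite (nonadjacent) edges replaced by `m` and
`m′` parallel copies respectively. -/
@[reducible] def K4m (m m' : ℕ) : MGraph where
  V := Fin 4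
  E := (Fin m ⊕ Fin m') ⊕ Fin 4
  src := fun e => match e with
    | .inl (.inl _) => 0
    | .inl (.inr _) => 2
    | .inr j => ![0, 0, 1, 1] j
  tgt := fun e => match e with
    | .inl (.inl _) => 1
    | .inl (.inr _) => 3
    | .inr j => ![2, 3, 2, 3] j

/-- `K₄''`: `K₄` with two adjacent edges doubled. -/
@[reducible] def K4dd : MGraph where
  V := Fin 4
  E := Fin 8
  src := ![0, 0, 0, 0, 0, 1, 1, 2]
  tgt := ![1, 1, 2, 2, 3, 2, 3, 3]

/-- The `n`-spoke wheel `W_n`: rim vertices `Fin n` and a hub; `inl i` is the rim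
edge from `v_i` to `v_{i+1}` and `inr i` is the spoke from the hub to `v_i`. -/
@[reducible] def wheel (n : ℕ) : MGraph where
  V := Fin n ⊕ Unit
  E := Fin n ⊕ Fin n
  src := fun e => match e with
    | .inl i => Sum.inl i
    | .inr _ => Sum.inr ()
  tgt := fun e => match e with
    | .inl i => Sum.inl ⟨(i.1 + 1) % n, Nat.mod_lt _ i.pos⟩
    | .inr i => Sum.inl i

instance (n : ℕ) : Finite ((wheel n).E) := inferInstanceAs (Finite (Fin n ⊕ Fin n))

/-- The indicator of an edge set, as a binary chain. -/
def indicatorCycle (Γ : MGraph) [Finite Γ.E] (D : Set Γ.E) : Γ.E →₀ ZMod 2 :=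
  Finsupp.equivFunOnFinite.symm fun e => if e ∈ D then 1 else 0

/-- The edge set of the Hamiltonian circle of `W_n` omitting the rim edge `r`:
all rim edges except `r`, together with the two spokes at the ends of `r`. -/
def wheelHamSet (n : ℕ) (r : Fin n) : Set (wheel n).E :=
  {e | Sum.elim (fun j : Fin n => j ≠ r)
      (fun j : Fin n => j = r ∨ j = ⟨(r.1 + 1) % n, Nat.mod_lt _ r.pos⟩) e}

/-- The set of (indicators of) the `n` Hamiltonian circles of the wheel `W_n`. -/
def wheelHamBasis (n : ℕ) : Set ((wheel n).E →₀ ZMod 2) :=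
  {c | ∃ r : Fin n, c = indicatorCycle (wheel n) (wheelHamSet n r)}

/-- A theta graph: a graph homeomorphic to a triple link. -/
def IsThetaGraph (Δ : MGraph) : Prop := Homeomorphic Δ (banana 3)

end MGraph

end

noncomputable section

attribute [local instance] Classical.propDecidable

namespace MGraph

theorem split_of_not_nodup {α β : Type} (f : α → β) (l : List α) (h : ¬ (l.map f).Nodup) :
    ∃ (x y z : List α) (s t : α), l = x ++ s :: (y ++ t :: z) ∧ f s = f t := by
  induction l with
  | nil => simp at h
  | cons a l ih =>
    by_cases ha : f a ∈ l.map f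
    · obtain ⟨t, ht, hft⟩ := List.mem_map.1 ha
      obtain ⟨y, z, rfl⟩ := List.append_of_mem ht
      exact ⟨[], y, z, a, t, rfl, hft.symm⟩
    · rw [List.map_cons, List.nodup_cons] at h
      obtain ⟨x, y, z, s, t, rfl, hst⟩ := ih (fun h' => h ⟨ha, h'⟩)
      exact ⟨a :: x, y, z, s, t, rfl, hst⟩

/-- The mod-2 edge class of a list of steps. -/
def cls (Γ : MGraph) (l : List Γ.Step) : Γ.E →₀ ZMod 2 :=
  (l.map fun s => Finsupp.single s.1 (1 : ZMod 2)).sum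

theorem cls_nil (Γ : MGraph) : Γ.cls [] = 0 := by simp [cls]

theorem cls_cons (Γ : MGraph) (s : Γ.Step) (l : List Γ.Step) :
    Γ.cls (s :: l) = Finsupp.single s.1 1 + Γ.cls l := by simp [cls]

theorem cls_append (Γ : MGraph) (l m : List Γ.Step) :
    Γ.cls (l ++ m) = Γ.cls l + Γ.cls m := by simp [cls]

theorem cls_apply (Γ : MGraph) (l : List Γ.Step) (e : Γ.E) :
    Γ.cls l e = (countIn (Γ.walkEdges l) e : ZMod 2) := by
  induction l with
  | nil => simp [cls, countIn, walkEdges]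
  | cons s l ih =>
    rw [cls_cons, Finsupp.add_apply, ih]
    simp only [countIn, walkEdges, List.map_cons, List.sum_cons, Nat.cast_add]
    congr 1
    by_cases hs : s.1 = e
    · simp [hs]
    · simp [hs]

theorem orientation_cls (Γ : MGraph) {v : Γ.V} {l : List Γ.Step} (hl : Γ.IsWalkFrom v v l) :
    Γ.IsCyclicOrientation (Γ.cls l) l := ⟨⟨v, hl⟩, fun e => Γ.cls_apply l e⟩

theorem eq_cls (Γ : MGraph) {c : Γ.E →₀ ZMod 2} {l : List Γ.Step}
    (h : Γ.IsCyclicOrientation c l) : c = Γ.cls l := by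
  ext e
  rw [h.2 e, cls_apply]

theorem add_self2 {α : Type} (x : α →₀ ZMod 2) : x + x = 0 := by
  ext a
  exact CharTwo.add_self_eq_zero (x a)

theorem boundary_single (Γ : MGraph) (e : Γ.E) (x : ZMod 2) :
    Γ.boundary (Finsupp.single e x) = Finsupp.single (Γ.src e) x + Finsupp.single (Γ.tgt e) x := by
  simp [boundary]

theorem boundary_step (Γ : MGraph) (s : Γ.Step) :
    Γ.boundary (Finsupp.single s.1 1) =
      Finsupp.single (Γ.stepStart s) 1 + Finsupp.single (Γ.stepEnd s) 1 := by
  rw [boundary_single]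
  rcases s with ⟨e, _ | _⟩
  · simp [stepStart, stepEnd, add_comm]
  · simp [stepStart, stepEnd]

theorem boundary_walk (Γ : MGraph) {a b : Γ.V} {l : List Γ.Step} (h : Γ.IsWalkFrom a b l) :
    Γ.boundary (Γ.cls l) = Finsupp.single a 1 + Finsupp.single b 1 := by
  induction h with
  | nil v => rw [cls_nil, map_zero, add_self2]
  | @cons a b s l hs hw ih =>
    rw [cls_cons, map_add, ih, boundary_step, hs]
    rw [add_assoc, ← add_assoc (Finsupp.single (Γ.stepEnd s) 1), add_self2, zero_add]

theorem walk_append (Γ : MGraph) {a b c : Γ.V} {l m : List Γ.Step} (h : Γ.IsWalkFrom a b l)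
    (h' : Γ.IsWalkFrom b c m) : Γ.IsWalkFrom a c (l ++ m) := by
  induction h with
  | nil v => exact h'
  | cons hs hw ih => exact .cons hs (ih h')

theorem walk_split (Γ : MGraph) {a c : Γ.V} (l : List Γ.Step) {s : Γ.Step} {m : List Γ.Step}
    (h : Γ.IsWalkFrom a c (l ++ s :: m)) :
    Γ.IsWalkFrom a (Γ.stepStart s) l ∧ Γ.IsWalkFrom (Γ.stepStart s) c (s :: m) := by
  induction l generalizing a with
  | nil =>
    cases h with
    | cons hs hw => subst hs; exact ⟨.nil _, .cons rfl hw⟩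
  | cons t l ih =>
    cases h with
    | cons hs hw => exact ⟨.cons hs (ih hw).1, (ih hw).2⟩

/-- Reversal of a step. -/
def revStep (Γ : MGraph) (s : Γ.Step) : Γ.Step := (s.1, !s.2)

theorem start_rev (Γ : MGraph) (s : Γ.Step) : Γ.stepStart (Γ.revStep s) = Γ.stepEnd s := by
  rcases s with ⟨e, _ | _⟩ <;> simp [stepStart, stepEnd, revStep]

theorem end_rev (Γ : MGraph) (s : Γ.Step) : Γ.stepEnd (Γ.revStep s) = Γ.stepStart s := by
  rcases s with ⟨e, _ | _⟩ <;> simp [stepStart, stepEnd, revStep]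

theorem walk_one (Γ : MGraph) (s : Γ.Step) :
    Γ.IsWalkFrom (Γ.stepStart s) (Γ.stepEnd s) [s] := .cons rfl (.nil _)

theorem walk_rev (Γ : MGraph) {a b : Γ.V} {l : List Γ.Step} (h : Γ.IsWalkFrom a b l) :
    ∃ m, Γ.IsWalkFrom b a m ∧ Γ.cls m = Γ.cls l ∧ ∀ s ∈ m, ∃ t ∈ l, t.1 = s.1 := by
  induction h with
  | nil v => exact ⟨[], .nil _, rfl, by simp⟩
  | @cons a b s l hs hw ih =>
    obtain ⟨m, hm, hmc, hmS⟩ := ih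
    refine ⟨m ++ [Γ.revStep s], Γ.walk_append hm ?_, ?_, ?_⟩
    · have := Γ.walk_one (Γ.revStep s)
      rwa [start_rev, end_rev, hs] at this
    · rw [cls_append, cls_cons, cls_cons, cls_nil, hmc, add_zero, add_comm]
      rfl
    · intro t ht
      rcases List.mem_append.1 ht with ht | ht
      · obtain ⟨u, hu, hut⟩ := hmS t ht
        exact ⟨u, List.mem_cons_of_mem _ hu, hut⟩
      · rw [List.mem_singleton] at ht
        subst ht
        exact ⟨s, List.mem_cons_self, rfl⟩

/-- `x` and `y` are joined by a walk in `S`. -/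
def SConn (Γ : MGraph) (S : Set Γ.E) (a b : Γ.V) : Prop :=
  ∃ l, Γ.IsWalkFrom a b l ∧ ∀ s ∈ l, s.1 ∈ S

theorem SConn.symm {Γ : MGraph} {S : Set Γ.E} {a b : Γ.V} (h : Γ.SConn S a b) :
    Γ.SConn S b a := by
  obtain ⟨l, hl, hS⟩ := h
  obtain ⟨m, hm, -, hmS⟩ := Γ.walk_rev hl
  refine ⟨m, hm, fun s hs => ?_⟩
  obtain ⟨t, ht, hts⟩ := hmS s hs
  exact hts ▸ hS t ht

theorem SConn.trans {Γ : MGraph} {S : Set Γ.E} {a b c : Γ.V} (h : Γ.SConn S a b)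
    (h' : Γ.SConn S b c) : Γ.SConn S a c := by
  obtain ⟨l, hl, hS⟩ := h
  obtain ⟨m, hm, hmS⟩ := h'
  refine ⟨l ++ m, Γ.walk_append hl hm, fun t ht => ?_⟩
  rcases List.mem_append.1 ht with ht | ht
  · exact hS t ht
  · exact hmS t ht

theorem sconn_of_quot (Γ : MGraph) (S : Set Γ.E) {a b : Γ.V}
    (h : Quot.mk (Γ.contractRel S) a = Quot.mk (Γ.contractRel S) b) : Γ.SConn S a b := by
  have h' := Quot.eqvGen_exact h
  clear h
  induction h' with
  | rel x y hxy =>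
    obtain ⟨e, he, rfl, rfl⟩ := hxy
    refine ⟨[(e, true)], ?_, by simpa using he⟩
    have := Γ.walk_one (e, true)
    simpa [stepStart, stepEnd] using this
  | refl x => exact ⟨[], .nil _, by simp⟩
  | symm x y _ ih => exact ih.symm
  | trans x y z _ _ ih ih' => exact ih.trans ih'

section Gain

variable {G : Type} [Group G]

theorem gain_append (Γ : MGraph) (g : Γ.E → G) (l m : List Γ.Step) :
    Γ.walkGain g (l ++ m) = Γ.walkGain g l * Γ.walkGain g m := by simp [walkGain]

theorem gain_cons (Γ : MGraph) (g : Γ.E → G) (s : Γ.Step) (m : List Γ.Step) :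
    Γ.walkGain g (s :: m) = Γ.stepGain g s * Γ.walkGain g m := by simp [walkGain]

/-- Edge classes of closed walks of gain one. -/
def goodCls (Γ : MGraph) (g : Γ.E → G) : Set (Γ.E →₀ ZMod 2) :=
  {c | ∃ l, Γ.IsCyclicOrientation c l ∧ Γ.walkGain g l = 1}

theorem balanced_of_span (Γ : MGraph) (g : Γ.E → G) (hv : Γ.BCTValid g)
    (hs : Γ.cycleSpace ≤ Submodule.span (ZMod 2) (Γ.goodCls g)) : Γ.IsBalanced g := by
  obtain ⟨b, hbT, hspan, hli⟩ := exists_linearIndependent (ZMod 2) (Γ.goodCls g)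
  refine hv ⟨b, ⟨?_, hli, ?_⟩, fun c hc => hbT hc⟩
  · intro c hc
    obtain ⟨l, hl, -⟩ := hbT hc
    obtain ⟨v, hw⟩ := hl.1
    rw [Γ.eq_cls hl, cycleSpace, LinearMap.mem_ker, Γ.boundary_walk hw, add_self2]
  · intro c hc
    rw [hspan]
    exact hs hc

/-- In a balanced gain graph every closed walk has gain one. -/
theorem closed_gain (Γ : MGraph) (g : Γ.E → G) (hb : Γ.IsBalanced g) (n : ℕ) :
    ∀ (v : Γ.V) (l : List Γ.Step), l.length = n → Γ.IsWalkFrom v v l → Γ.walkGain g l = 1 := by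
  induction n using Nat.strong_induction_on with
  | _ n ih =>
  intro v l hn hw
  by_cases h0 : l = []
  · subst h0; simp [walkGain]
  have key : ∀ (x y z : List Γ.Step) (s t : Γ.Step),
        l = x ++ s :: (y ++ t :: z) → Γ.stepStart s = Γ.stepStart t → Γ.walkGain g l = 1 := by
    rintro x y z s t rfl hst
    obtain ⟨h1, h2⟩ := Γ.walk_split x hw
    obtain ⟨h3, h4⟩ := Γ.walk_split (s :: y) (m := z) (s := t) h2
    rw [← hst] at h3 h4
    have e1 := ih _ (by simp at hn ⊢; omega) _ _ rfl h3
    have e2 := ih _ (by simp at hn ⊢; omega) _ _ rfl (Γ.walk_append h1 h4)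
    rw [gain_append] at e2
    rw [← List.cons_append, gain_append, gain_append, e1, one_mul, e2]
  by_cases hst : (l.map Γ.stepStart).Nodup
  · by_cases hed : (Γ.walkEdges l).Nodup
    · exact hb v l hw ⟨h0, hed, hst⟩
    · obtain ⟨x, y, z, s, t, hl, hs⟩ := split_of_not_nodup _ _ hed
      by_cases h2 : s.2 = t.2
      · exact key x y z s t hl (by rw [Prod.ext hs h2])
      · have ht : t = Γ.revStep s := by
          refine Prod.ext hs.symm ?_
          simp only [revStep]
          revert h2
          cases s.2 <;> cases t.2 <;> simp
        subst ht
        subst hl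
        obtain ⟨h1, h2⟩ := Γ.walk_split x hw
        cases h2 with
        | cons _ h3 =>
        obtain ⟨h4, h5⟩ := Γ.walk_split y h3
        rw [start_rev] at h4
        cases h5 with
        | cons _ h6 =>
        rw [end_rev] at h6
        have e1 := ih _ (by simp at hn ⊢; omega) _ _ rfl h4
        have e2 := ih _ (by simp at hn ⊢; omega) _ _ rfl (Γ.walk_append h1 h6)
        rw [gain_append] at e2
        have e3 : Γ.stepGain g s * Γ.stepGain g (Γ.revStep s) = 1 := by
          rcases s with ⟨e, _ | _⟩ <;> simp [stepGain, revStep]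
        rw [gain_append, gain_cons, gain_append, gain_cons, e1, one_mul,
          ← mul_assoc (Γ.stepGain g s), e3,
          one_mul, e2]
  · obtain ⟨x, y, z, s, t, hl, hs⟩ := split_of_not_nodup _ _ hst
    exact key x y z s t hl hs

/-- Extension of a gain function by `1` on contracted edges. -/
def extGain (Γ : MGraph) (S : Set Γ.E) (g : (Γ.contract S).E → G) : Γ.E → G :=
  fun e => if h : e ∈ S then 1 else g ⟨e, h⟩

theorem gain_S (Γ : MGraph) (S : Set Γ.E) (g : (Γ.contract S).E → G) (l : List Γ.Step)
    (h : ∀ s ∈ l, s.1 ∈ S) : Γ.walkGain (Γ.extGain S g) l = 1 := by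
  induction l with
  | nil => simp [walkGain]
  | cons s l ih =>
    rw [gain_cons, ih (fun t ht => h t (List.mem_cons_of_mem _ ht)), mul_one]
    have := h s List.mem_cons_self
    simp [stepGain, extGain, this]

/-- Restriction of chains to the uncontracted edges. -/
def restr (Γ : MGraph) (S : Set Γ.E) :
    (Γ.E →₀ ZMod 2) →ₗ[ZMod 2] ((Γ.contract S).E →₀ ZMod 2) :=
  Finsupp.lcomapDomain (fun e : (Γ.contract S).E => (e.1 : Γ.E)) Subtype.val_injective

theorem restr_apply (Γ : MGraph) (S : Set Γ.E) (c : Γ.E →₀ ZMod 2) (e : (Γ.contract S).E) :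
    Γ.restr S c e = c e.1 := rfl

theorem restr_mem (Γ : MGraph) (S : Set Γ.E) {e : Γ.E} (he : e ∈ S) (x : ZMod 2) :
    Γ.restr S (Finsupp.single e x) = 0 := by
  ext f
  rw [restr_apply, Finsupp.single_eq_of_ne]
  · rfl
  · intro hf
    exact f.2 (hf ▸ he)

theorem restr_notMem (Γ : MGraph) (S : Set Γ.E) (e : (Γ.contract S).E) (x : ZMod 2) :
    Γ.restr S (Finsupp.single e.1 x) = Finsupp.single e x := by
  ext f
  rw [restr_apply]
  by_cases h : e = f
  · subst h; simp
  · rw [Finsupp.single_eq_of_ne (Ne.symm h), Finsupp.single_eq_of_ne]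
    intro hf
    exact h (Subtype.ext hf.symm)

theorem restr_S (Γ : MGraph) (S : Set Γ.E) (l : List Γ.Step)
    (h : ∀ s ∈ l, s.1 ∈ S) : Γ.restr S (Γ.cls l) = 0 := by
  induction l with
  | nil => simp [cls_nil]
  | cons s l ih =>
    rw [cls_cons, map_add, ih (fun t ht => h t (List.mem_cons_of_mem _ ht)), add_zero]
    exact Γ.restr_mem S (h s List.mem_cons_self) 1

theorem restr_cycle (Γ : MGraph) (S : Set Γ.E) (c : Γ.E →₀ ZMod 2) (hc : c ∈ Γ.cycleSpace) :
    Γ.restr S c ∈ (Γ.contract S).cycleSpace := by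
  let q : Γ.V → (Γ.contract S).V := Quot.mk (Γ.contractRel S)
  have key : (Γ.contract S).boundary ∘ₗ Γ.restr S =
      Finsupp.lmapDomain (ZMod 2) (ZMod 2) q ∘ₗ Γ.boundary := by
    apply Finsupp.lhom_ext
    intro e x
    rw [LinearMap.comp_apply, LinearMap.comp_apply, boundary_single, map_add,
      Finsupp.lmapDomain_apply, Finsupp.lmapDomain_apply,
      Finsupp.mapDomain_single, Finsupp.mapDomain_single]
    by_cases he : e ∈ S
    · have hq : q (Γ.src e) = q (Γ.tgt e) := Quot.sound ⟨e, he, rfl, rfl⟩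
      rw [restr_mem _ _ he, map_zero, hq, add_self2]
    · let e' : (Γ.contract S).E := ⟨e, he⟩
      have h1 : Γ.restr S (Finsupp.single e x) = Finsupp.single e' x := Γ.restr_notMem S e' x
      rw [h1, boundary_single]
      rfl
  have := LinearMap.congr_fun key c
  rw [cycleSpace, LinearMap.mem_ker] at hc ⊢
  rw [LinearMap.comp_apply, LinearMap.comp_apply, hc, map_zero] at this
  exact this

/-- Lift a walk of the contraction. -/
theorem lift_walk (Γ : MGraph) (S : Set Γ.E) (g : (Γ.contract S).E → G)
    {p q : (Γ.contract S).V} {l : List (Γ.contract S).Step}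
    (h : (Γ.contract S).IsWalkFrom p q l) :
    ∀ a b : Γ.V, Quot.mk _ a = p → Quot.mk _ b = q →
    ∃ m, Γ.IsWalkFrom a b m ∧ Γ.walkGain (Γ.extGain S g) m = (Γ.contract S).walkGain g l ∧
      Γ.restr S (Γ.cls m) = (Γ.contract S).cls l := by
  induction h with
  | nil v =>
    intro a b ha hb
    obtain ⟨m, hm, hS⟩ := Γ.sconn_of_quot S (ha.trans hb.symm)
    refine ⟨m, hm, ?_, ?_⟩
    · rw [gain_S _ _ _ _ hS]; simp [walkGain]
    · rw [restr_S _ _ _ hS, cls_nil]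
  | @cons p q s l hs hw ih =>
    intro a b ha hb
    let s' : Γ.Step := (s.1.1, s.2)
    have hs1 : Quot.mk _ (Γ.stepStart s') = (Γ.contract S).stepStart s := by
      rcases s with ⟨e, _ | _⟩ <;> simp [s', stepStart, contract]
    have hs2 : Quot.mk _ (Γ.stepEnd s') = (Γ.contract S).stepEnd s := by
      rcases s with ⟨e, _ | _⟩ <;> simp [s', stepEnd, contract]
    obtain ⟨m, hm, hg, hr⟩ := ih (Γ.stepEnd s') b hs2 hb
    obtain ⟨k, hk, hS⟩ := Γ.sconn_of_quot S (ha.trans (hs.symm.trans hs1.symm))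
    refine ⟨k ++ s' :: m, Γ.walk_append hk (.cons rfl hm), ?_, ?_⟩
    · rw [gain_append, gain_S _ _ _ _ hS, one_mul, gain_cons, gain_cons, hg]
      congr 1
      have : s.1.1 ∉ S := s.1.2
      simp only [stepGain, extGain, s', this, dite_false]
      rfl
    · rw [cls_append, map_add, restr_S _ _ _ hS, zero_add, cls_cons, cls_cons, map_add, hr]
      rw [← Γ.restr_notMem S s.1]

/-- A cycle vanishing off `S` is a combination of classes of closed walks in `S`. -/
theorem S_cycle (Γ : MGraph) (S : Set Γ.E) (g : (Γ.contract S).E → G) (c : Γ.E →₀ ZMod 2)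
    (hc : c ∈ Γ.cycleSpace) (h0 : Γ.restr S c = 0) :
    c ∈ Submodule.span (ZMod 2) (Γ.goodCls (Γ.extGain S g)) := by
  have hr : ∀ v : Γ.V, Γ.SConn S (Quot.mk (Γ.contractRel S) v).out v := fun v =>
    Γ.sconn_of_quot S (Quot.out_eq _)
  choose P hP hPS using hr
  let p : (Γ.V →₀ ZMod 2) →ₗ[ZMod 2] (Γ.E →₀ ZMod 2) :=
    Finsupp.linearCombination (ZMod 2) (fun v => Γ.cls (P v))
  let φ : (Γ.E →₀ ZMod 2) →ₗ[ZMod 2] (Γ.E →₀ ZMod 2) := LinearMap.id + p ∘ₗ Γ.boundary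
  have hφc : φ c = c := by
    rw [cycleSpace, LinearMap.mem_ker] at hc
    simp [φ, hc]
  rw [← hφc, ← Finsupp.sum_single c, Finsupp.sum, map_sum]
  refine Submodule.sum_mem _ fun e he => ?_
  have heS : e ∈ S := by
    by_contra hn
    have := DFunLike.congr_fun h0 (⟨e, hn⟩ : (Γ.contract S).E)
    exact (Finsupp.mem_support_iff.1 he) this
  rw [← mul_one (c e), ← smul_eq_mul, ← Finsupp.smul_single, map_smul]
  refine Submodule.smul_mem _ _ (Submodule.subset_span ?_)
  have hroot : (Quot.mk (Γ.contractRel S) (Γ.src e)).out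
      = (Quot.mk (Γ.contractRel S) (Γ.tgt e)).out :=
    congrArg _ (Quot.sound ⟨e, heS, rfl, rfl⟩)
  have w1 := hP (Γ.src e)
  have w2 : Γ.IsWalkFrom (Γ.src e) (Γ.tgt e) [(e, true)] := by
    simpa [stepStart, stepEnd] using Γ.walk_one (e, true)
  have w3 := hP (Γ.tgt e)
  rw [← hroot] at w3
  obtain ⟨m, hm, hmc, hmS⟩ := Γ.walk_rev w3
  have hcl : φ (Finsupp.single e 1) = Γ.cls (P (Γ.src e) ++ ([(e, true)] ++ m)) := by
    rw [cls_append, cls_append, hmc, cls_cons, cls_nil, add_zero]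
    simp only [φ, p, LinearMap.add_apply, LinearMap.id_apply, LinearMap.comp_apply,
      boundary_single, map_add, Finsupp.linearCombination_single, one_smul]
    abel
  rw [hcl]
  refine ⟨_, Γ.orientation_cls (Γ.walk_append w1 (Γ.walk_append w2 hm)), Γ.gain_S S g _ ?_⟩
  intro s hs
  rcases List.mem_append.1 hs with hs | hs
  · exact hPS _ s hs
  rcases List.mem_append.1 hs with hs | hs
  · rw [List.mem_singleton] at hs
    subst hs
    exact heS
  · obtain ⟨t, ht, hts⟩ := hmS s hs
    exact hts ▸ hPS _ t ht

end Gain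

end MGraph

end

/-- If the Binary Cycle Test is valid for every gain graph on `Γ`
with gain group `G`, then it is valid for every gain graph on `Γ/S` with gain
group `G`. -/
theorem bct_valid_contraction (G : Type) [Group G] (Γ : MGraph)
    (h : ∀ g : Γ.E → G, Γ.BCTValid g) (S : Set Γ.E) :
    ∀ g : (Γ.contract S).E → G, (Γ.contract S).BCTValid g := by
  intro g hB
  obtain ⟨B, ⟨hB1, hB2, hB3⟩, hpass⟩ := hB
  have hbal : Γ.IsBalanced (Γ.extGain S g) := by
    refine Γ.balanced_of_span _ (h _) fun c hc => ?_
    have h1 := hB3 _ (Γ.restr_cycle S c hc)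
    have hle : Submodule.span (ZMod 2) B ≤ (Submodule.span (ZMod 2)
        (Γ.goodCls (Γ.extGain S g)) ⊓ Γ.cycleSpace).map (Γ.restr S) := by
      rw [Submodule.span_le]
      intro d hd
      obtain ⟨l, hl, hg⟩ := hpass d hd
      obtain ⟨v, hv⟩ := hl.1
      obtain ⟨a, rfl⟩ := Quot.exists_rep v
      obtain ⟨m, hm, hmg, hmr⟩ := Γ.lift_walk S g hv a a rfl rfl
      refine ⟨Γ.cls m, ⟨Submodule.subset_span ⟨m, Γ.orientation_cls hm, hmg.trans hg⟩, ?_⟩, ?_⟩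
      · change Γ.boundary (Γ.cls m) = 0
        rw [Γ.boundary_walk hm, MGraph.add_self2]
      · rw [hmr, ← MGraph.eq_cls _ hl]
    obtain ⟨d, ⟨hd1, hd2⟩, hdr⟩ := hle h1
    have h2 := Γ.S_cycle S g (c - d) (Submodule.sub_mem _ hc hd2)
      (by rw [map_sub, hdr, sub_self])
    have := Submodule.add_mem _ h2 hd1
    rwa [sub_add_cancel] at this
  intro v l hw _
  obtain ⟨a, rfl⟩ := Quot.exists_rep v
  obtain ⟨m, hm, hmg, -⟩ := Γ.lift_walk S g hw a a rfl rfl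
  rw [← hmg]
  exact Γ.closed_gain _ hbal _ a m rfl hm
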